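/- arXiv:math/0409299 — 7 statements merged into one kernel-verified Lean document; each statement's English description precedes it below -/
import Mathlib

section
/- Let m be any multiplier on an abelian group G. Then the commutator m∼(x,y) = m(x,y)/m(y,x) is an alternating bihomomorphism: m∼(x,x) = 1 and m∼(x,y)·m∼(y,x) = 1 for all x,y ∈ G, and m∼ is a group homomorphism in each variable separately, i.e. m∼(x, y+z) = m∼(x,y)·m∼(x,z) and m∼(x+y, z) = m∼(x,z)·m∼(y,z) for all x,y,z ∈ G. -/
/-- For any multiplier `m` on an abelian group `G`, the commutator
`m∼(x,y) = m(x,y)/m(y,x)` is an alternating bihomomorphism. -/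
theorem stmt_4 {G : Type*} [AddCommGroup G]
    (m : G → G → Circle)
    (hm0 : ∀ x : G, m x 0 = 1 ∧ m 0 x = 1)
    (hmc : ∀ x y z : G, m (x + y) z * m x y = m x (y + z) * m y z) :
    (∀ x : G, m x x / m x x = 1) ∧
    (∀ x y : G, (m x y / m y x) * (m y x / m x y) = 1) ∧
    (∀ x y z : G, m x (y + z) / m (y + z) x = (m x y / m y x) * (m x z / m z x)) ∧
    (∀ x y z : G, m (x + y) z / m z (x + y) = (m x z / m z x) * (m y z / m z y)) := by
  have h_right (x y z : G) :
      m x (y + z) / m (y + z) x = (m x y / m y x) * (m x z / m z x) := by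
    have h₁ := hmc x y z
    have h₂ := hmc y x z
    have h₃ := hmc y z x
    rw [add_comm y x] at h₂
    rw [add_comm z x] at h₃
    rw [eq_div_of_mul_eq' h₁.symm, eq_div_of_mul_eq' h₃, div_div_div_cancel_right,
      ← div_mul_div_comm, div_eq_div_iff_mul_eq_mul.2 (h₂.trans (mul_comm _ _)),
      div_mul_div_comm, div_mul_div_comm, mul_comm (m x z)]
  refine ⟨fun x => div_self' _, fun x y => by simp, h_right, fun x y z => ?_⟩
  simpa only [inv_div, mul_inv] using congrArg (·⁻¹) (h_right z x y)
end

section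
/- Standing hypotheses as in the context, and assume H^L ≠ {0}. Then for x ∈ G one has W(x)H^L ⊆ H^L if and only if 2x ∈ L; that is, (1/2)L is the normalizer of the vacuum space H^L. Moreover, for every x ∈ (1/2)L, every b ∈ L and every ψ ∈ H^L, W(x + 2b)ψ = W(x)ψ; i.e. the action of W restricted to (1/2)L on H^L factors through (1/2)L / 2L. -/
/-- An alternating bihomomorphism is antisymmetric. -/
theorem mul_swap_eq_one_of_alternating {G M : Type*} [AddCommGroup G] [CommMonoid M]
    {m : G → G → M}
    (hm₁ : ∀ x y z : G, m (x + y) z = m x z * m y z)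
    (hm₂ : ∀ x y z : G, m x (y + z) = m x y * m x z)
    (hmalt : ∀ x : G, m x x = 1) (x y : G) : m x y * m y x = 1 := by
  simpa [hm₁, hm₂, hmalt] using hmalt (x + y)


/-- Standing hypotheses; assume the vacuum space
`H^L = {ψ : W(a)ψ = ψ ∀ a ∈ L}` is nonzero. Then for `x ∈ G`, `W(x)` maps `H^L` into
itself iff `2x ∈ L`; and for `x ∈ (1/2)L`, `b ∈ L`, `ψ ∈ H^L`, `W(x+2b)ψ = W(x)ψ`. -/
theorem stmt_7 {G : Type*} [AddCommGroup G]
    (m : G → G → Circle)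
    (hm₁ : ∀ x y z : G, m (x + y) z = m x z * m y z)
    (hm₂ : ∀ x y z : G, m x (y + z) = m x y * m x z)
    (hmalt : ∀ x : G, m x x = 1)
    (L : AddSubgroup G)
    (hL : (L : Set G) = {x : G | ∀ a ∈ L, m x a = 1})
    {H : Type*} [NormedAddCommGroup H] [InnerProductSpace ℂ H] [CompleteSpace H]
    (W : G → H →L[ℂ] H)
    (hW0 : W 0 = 1)
    (hWmul : ∀ x y : G, (W x).comp (W y) = (m x y : ℂ) • W (x + y))
    (hWunitary : ∀ (x : G) (ψ φ : H), @inner ℂ H _ (W x ψ) (W x φ) = @inner ℂ H _ ψ φ)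
    (hvac : ∃ ψ : H, ψ ≠ 0 ∧ ∀ a ∈ L, W a ψ = ψ) :
    (∀ x : G,
      ((∀ ψ : H, (∀ a ∈ L, W a ψ = ψ) → ∀ a ∈ L, W a (W x ψ) = W x ψ) ↔ x + x ∈ L)) ∧
    (∀ x : G, x + x ∈ L → ∀ b ∈ L, ∀ ψ : H, (∀ a ∈ L, W a ψ = ψ) →
      W (x + (b + b)) ψ = W x ψ) := by
  have hmem : ∀ x : G, x ∈ L ↔ ∀ a ∈ L, m x a = 1 := fun x => by
    rw [← SetLike.mem_coe, hL, Set.mem_ofPred_eq]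
  have hcomp : ∀ (x y : G) (ψ : H), W x (W y ψ) = (m x y : ℂ) • W (x + y) ψ := fun x y ψ => by
    simpa using DFunLike.congr_fun (hWmul x y) ψ
  have hne : ∀ (x : G) (ψ : H), ψ ≠ 0 → W x ψ ≠ 0 := by
    intro x ψ hψ h
    have hinner := hWunitary x ψ ψ
    rw [h, inner_zero_left] at hinner
    exact hψ (inner_self_eq_zero.mp hinner.symm)
  have hswap := mul_swap_eq_one_of_alternating hm₁ hm₂ hmalt
  refine ⟨fun x => ⟨fun h => ?_, fun h ψ hψ a ha => ?_⟩, fun x hx b hb ψ hψ => ?_⟩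
  · obtain ⟨ψ, hψ0, hψ⟩ := hvac
    refine (hmem _).2 fun a ha => ?_
    have hfix : W a (W x ψ) = W x (W a ψ) := by rw [h ψ hψ a ha, hψ a ha]
    rw [hcomp, hcomp, add_comm x a] at hfix
    have hsymm : m a x = m x a := Circle.ext (smul_left_injective ℂ (hne (a + x) ψ hψ0) hfix)
    have hone := hswap x a
    rwa [hsymm, ← hm₁] at hone
  · have hsq : m x a * m x a = m x a * m a x := by
      rw [hswap, ← hm₁, (hmem _).1 h a ha]
    rw [hcomp, ← mul_left_cancel hsq, add_comm a x, ← hcomp, hψ a ha]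
  · have hone : m x (b + b) = 1 := by
      rw [hm₂, ← hm₁, (hmem _).1 hx b hb]
    have hfix := hcomp x (b + b) ψ
    rw [hψ _ (L.add_mem hb hb), hone, Circle.coe_one, one_smul] at hfix
    exact hfix.symm
end

section
/- Standing hypotheses as in the context; assume H^L ≠ {0}, H(H^L) = H, and that the quotient group ((1/2)L)/(2L) is finite. If W is irreducible, then the vacuum space H^L is finite-dimensional. -/
/-- The doubling homomorphism `x ↦ x + x` of an abelian group. -/
def doublingHom (G : Type*) [AddCommGroup G] : G →+ G :=
  AddMonoidHom.id G + AddMonoidHom.id G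

/-- The smallest closed subspace of `H` containing `K` and invariant under all `W x`. -/
def smallestInvariantSubspace {G : Type*} {H : Type*} [NormedAddCommGroup H]
    [InnerProductSpace ℂ H] (W : G → H →L[ℂ] H) (K : Set H) : Submodule ℂ H :=
  sInf {S : Submodule ℂ H |
    K ⊆ (S : Set H) ∧ IsClosed (S : Set H) ∧ ∀ (x : G), ∀ ψ ∈ S, W x ψ ∈ S}

/-- Standing hypotheses; assume `H^L ≠ {0}`, `H(H^L) = H`, and the quotient
`((1/2)L)/(2L)` is finite. If `W` is irreducible, then `H^L` is finite-dimensional. -/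
theorem stmt_10 {G : Type*} [AddCommGroup G]
    (m : G → G → Circle)
    (hm₁ : ∀ x y z : G, m (x + y) z = m x z * m y z)
    (hm₂ : ∀ x y z : G, m x (y + z) = m x y * m x z)
    (hmalt : ∀ x : G, m x x = 1)
    (L : AddSubgroup G)
    (hL : (L : Set G) = {x : G | ∀ a ∈ L, m x a = 1})
    {H : Type*} [NormedAddCommGroup H] [InnerProductSpace ℂ H] [CompleteSpace H]
    (W : G → H →L[ℂ] H)
    (hW0 : W 0 = 1)
    (hWmul : ∀ x y : G, (W x).comp (W y) = (m x y : ℂ) • W (x + y))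
    (hWunitary : ∀ (x : G) (ψ φ : H), @inner ℂ H _ (W x ψ) (W x φ) = @inner ℂ H _ ψ φ)
    (HL : Submodule ℂ H)
    (hHL : ∀ ψ : H, ψ ∈ HL ↔ ∀ a ∈ L, W a ψ = ψ)
    (hvac : HL ≠ ⊥)
    (hgen : smallestInvariantSubspace W (HL : Set H) = ⊤)
    (hfin : Finite
      ((L.comap (doublingHom G)) ⧸ ((L.map (doublingHom G)).addSubgroupOf (L.comap (doublingHom G)))))
    (hirr : ∀ S : Submodule ℂ H, IsClosed (S : Set H) →
      (∀ x : G, ∀ ψ ∈ S, W x ψ ∈ S) → S = ⊥ ∨ S = ⊤) :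
    FiniteDimensional ℂ HL := by
  have hswap : ∀ x y : G, m x y * m y x = 1 := fun x y ↦ by
    have h := hmalt (x + y)
    rwa [hm₁, hm₂, hm₂, hmalt, hmalt, one_mul, mul_one] at h
  have hone : ∀ x ∈ L, ∀ a ∈ L, m x a = 1 := fun x hx ↦ by
    have hx' : x ∈ (L : Set G) := hx
    rwa [hL] at hx'
  have hdouble : ∀ x y : G, m (doublingHom G x) y = m x y * m x y := fun x y ↦ hm₁ x x y
  have hWW : ∀ x y ψ, W x (W y ψ) = (m x y : ℂ) • W (x + y) ψ := fun x y ψ ↦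
    DFunLike.congr_fun (hWmul x y) ψ
  have hWneg : ∀ y φ, W y (W (-y) φ) = φ := fun y φ ↦ by
    have h0 : m y (y + -y) = 1 := by
      have h := hm₂ y 0 0
      rw [add_zero] at h
      rw [add_neg_cancel]
      exact left_eq_mul.mp h
    rw [hm₂, hmalt, one_mul] at h0
    simp [hWW, h0, hW0]
  have htrans : ∀ ψ ∈ HL, ∀ x, ∀ a ∈ L, W x ψ = (m x a : ℂ) • W (x + a) ψ := fun ψ hψ x a ha ↦ by
    rw [← hWW, (hHL ψ).1 hψ a ha]
  have hcomm : ∀ x, doublingHom G x ∈ L → ∀ a ∈ L, m a x = m x a := fun x hx a ha ↦ by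
    have h1 := hone _ hx a ha
    rw [hdouble] at h1
    exact mul_left_cancel ((hswap x a).trans h1.symm)
  have hstable : ∀ ψ ∈ HL, ∀ x, doublingHom G x ∈ L → W x ψ ∈ HL := fun ψ hψ x hx ↦ by
    refine (hHL _).2 fun a ha ↦ ?_
    rw [hWW, hcomm x hx a ha, add_comm a x, ← htrans ψ hψ x a ha]
  have horth : ∀ ψ ∈ HL, ∀ φ ∈ HL, ∀ x, doublingHom G x ∉ L →
      inner ℂ (W x ψ) φ = 0 := fun ψ hψ φ hφ x hx ↦ by
    have hx' : doublingHom G x ∉ (L : Set G) := hx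
    rw [hL] at hx'
    simp only [Set.mem_ofPred_eq, not_forall] at hx'
    obtain ⟨a, ha, hxa⟩ := hx'
    have h1 : inner ℂ (W x ψ) φ =
        starRingEnd ℂ (m x a : ℂ) * inner ℂ (W (x + a) ψ) φ := by
      rw [htrans ψ hψ x a ha, inner_smul_left]
    have h2 : inner ℂ (W x ψ) φ =
        starRingEnd ℂ (m a x : ℂ) * inner ℂ (W (x + a) ψ) φ := by
      rw [← hWunitary a, (hHL φ).1 hφ a ha, hWW, inner_smul_left, add_comm a x]
    by_contra hne
    have ht : inner ℂ (W (x + a) ψ) φ ≠ 0 := fun h ↦ hne (by rw [h1, h, mul_zero])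
    have h3 := mul_right_cancel₀ ht (h1.symm.trans h2)
    have h4 : m x a = m a x := Circle.coe_injective ((starRingEnd ℂ).injective h3)
    apply hxa
    rw [hdouble]
    nth_rewrite 2 [h4]
    exact hswap x a
  obtain ⟨ψ, hψ, hψ0⟩ := HL.exists_mem_ne_zero_of_ne_bot hvac
  have hcyclic : ∀ φ, (∀ x, inner ℂ (W x ψ) φ = 0) → φ = 0 := by
    let S : Submodule ℂ H := ⨅ x, (ℂ ∙ W x ψ)ᗮ
    have hS : ∀ φ, φ ∈ S ↔ ∀ x, inner ℂ (W x ψ) φ = 0 := fun φ ↦ by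
      simp [S, Submodule.mem_iInf, Submodule.mem_orthogonal_singleton_iff_inner_right]
    have hclosed : IsClosed (S : Set H) := by
      rw [Submodule.coe_iInf]
      exact isClosed_iInter fun x ↦ Submodule.isClosed_orthogonal _
    have hinv : ∀ y, ∀ φ ∈ S, W y φ ∈ S := fun y φ hφ ↦ (hS _).2 fun x ↦ by
      rw [← hWneg y (W x ψ), hWunitary, hWW, inner_smul_left, (hS φ).1 hφ, mul_zero]
    have hbot : S = ⊥ := (hirr S hclosed hinv).resolve_right fun htop ↦ by
      have h := (hS ψ).1 (htop ▸ Submodule.mem_top) 0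
      rw [hW0] at h
      exact hψ0 (inner_self_eq_zero.1 h)
    intro φ hφ
    rw [← Submodule.mem_bot ℂ, ← hbot]
    exact (hS φ).2 hφ
  let half := L.comap (doublingHom G)
  let Q := half ⧸ (L.map (doublingHom G)).addSubgroupOf half
  have : Finite Q := hfin
  let K : Submodule ℂ H := Submodule.span ℂ (Set.range fun q : Q ↦ W (q.out : half) ψ)
  have : FiniteDimensional ℂ K := FiniteDimensional.span_of_finite ℂ (Set.finite_range _)
  have hK : ∀ x, doublingHom G x ∈ L → W x ψ ∈ K := fun x hx ↦ by
    let x' : half := ⟨x, hx⟩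
    let q : Q := QuotientAddGroup.mk x'
    have hq : -q.out + x' ∈ (L.map (doublingHom G)).addSubgroupOf half :=
      QuotientAddGroup.eq.1 (QuotientAddGroup.out_eq' q)
    obtain ⟨a, ha, hax⟩ := AddSubgroup.mem_addSubgroupOf.1 hq
    have h2a : doublingHom G a ∈ L := L.add_mem ha ha
    have hx2 : (q.out : G) + doublingHom G a = x := by
      rw [hax]
      simp [x']
    have hm : m (q.out : half) (doublingHom G a) = 1 := by
      have h : m (q.out : half) (doublingHom G a) = m (doublingHom G (q.out : half)) a := by
        rw [hdouble]
        exact hm₂ _ a a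
      rw [h]
      exact hone _ q.out.2 a ha
    have h := htrans ψ hψ (q.out : half) _ h2a
    rw [hm, hx2, Circle.coe_one, one_smul] at h
    rw [← h]
    exact Submodule.subset_span ⟨q, rfl⟩
  have hKHL : K ≤ HL := Submodule.span_le.2 <| by
    rintro _ ⟨q, rfl⟩
    exact hstable ψ hψ _ q.out.2
  have hHLK : HL ≤ K := fun φ hφ ↦ by
    have hsub : φ - K.starProjection φ = 0 := by
      refine hcyclic _ fun x ↦ ?_
      by_cases hx : doublingHom G x ∈ L
      · exact (K.mem_orthogonal _).1 (K.sub_starProjection_mem_orthogonal φ) _ (hK x hx)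
      · exact horth ψ hψ _ (HL.sub_mem hφ (hKHL (K.starProjection_apply_mem φ))) x hx
    rw [sub_eq_zero.1 hsub]
    exact K.starProjection_apply_mem φ
  exact Submodule.finiteDimensional_of_le hHLK
end

section
/- Standing hypotheses as in the context; assume H^L ≠ {0}, H(H^L) = H, that the doubling map x ↦ 2x is injective on G, and that L = 2L. Then W is irreducible if and only if the vacuum space H^L is one-dimensional. -/
/-- Vacuum vectors are orthogonal to their translates by elements outside `L`. -/
theorem inner_vacuum_translate_eq_zero {G : Type*} [AddCommGroup G]
    {m : G → G → Circle}
    (hm₁ : ∀ x y z : G, m (x + y) z = m x z * m y z)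
    (hm₂ : ∀ x y z : G, m x (y + z) = m x y * m x z)
    (hmalt : ∀ x : G, m x x = 1)
    {H : Type*} [NormedAddCommGroup H] [InnerProductSpace ℂ H]
    {W : G → H →L[ℂ] H}
    (hWmul : ∀ x y : G, (W x).comp (W y) = (m x y : ℂ) • W (x + y))
    (hWunitary : ∀ (x : G) (ψ φ : H), inner ℂ (W x ψ) (W x φ) = inner ℂ ψ φ)
    {a x : G} (hax : m x (a + a) ≠ 1) {φ ψ : H} (hφ : W a φ = φ) (hψ : W a ψ = ψ) :
    inner ℂ φ (W x ψ) = 0 := by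
  have hskew : m x a * m a x = 1 := by
    have h := hmalt (x + a)
    rwa [hm₁, hm₂, hm₂, hmalt, hmalt, one_mul, mul_one] at h
  have hxa : W x ψ = (m x a : ℂ) • W (x + a) ψ := by
    have h := congrArg (fun T => T ψ) (hWmul x a)
    simpa [hψ] using h
  have hcomm : (m x a : ℂ) • W a (W x ψ) = (m a x : ℂ) • W x ψ := by
    have h := congrArg (fun T => T ψ) (hWmul a x)
    simp only [ContinuousLinearMap.comp_apply, smul_apply] at h
    rw [h, smul_comm, add_comm a x, ← hxa]
  have hinner : (m x a : ℂ) * inner ℂ φ (W x ψ) = (m a x : ℂ) * inner ℂ φ (W x ψ) := by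
    calc (m x a : ℂ) * inner ℂ φ (W x ψ)
        = (m x a : ℂ) * inner ℂ (W a φ) (W a (W x ψ)) := by rw [hWunitary]
      _ = inner ℂ φ ((m x a : ℂ) • W a (W x ψ)) := by rw [hφ, inner_smul_right]
      _ = (m a x : ℂ) * inner ℂ φ (W x ψ) := by rw [hcomm, inner_smul_right]
  by_contra h0
  have heq : m x a = m a x := Subtype.ext (mul_right_cancel₀ h0 hinner)
  refine hax ?_
  rw [hm₂]
  nth_rewrite 2 [heq]
  exact hskew

/-- The orthogonal complement of an invariant subspace is invariant. -/
theorem map_mem_orthogonal_of_invariant {G : Type*} [AddCommGroup G]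
    {m : G → G → Circle}
    (hm₁ : ∀ x y z : G, m (x + y) z = m x z * m y z)
    (hmalt : ∀ x : G, m x x = 1)
    {H : Type*} [NormedAddCommGroup H] [InnerProductSpace ℂ H]
    {W : G → H →L[ℂ] H}
    (hW0 : W 0 = 1)
    (hWmul : ∀ x y : G, (W x).comp (W y) = (m x y : ℂ) • W (x + y))
    (hWunitary : ∀ (x : G) (ψ φ : H), inner ℂ (W x ψ) (W x φ) = inner ℂ ψ φ)
    {S : Submodule ℂ H} (hS : ∀ x : G, ∀ ψ ∈ S, W x ψ ∈ S)
    (x : G) {ψ : H} (hψ : ψ ∈ Sᗮ) : W x ψ ∈ Sᗮ := by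
  have hm0 : m 0 x = 1 := by
    have h := hm₁ 0 0 x
    rw [add_zero] at h
    exact left_eq_mul.mp h
  have hmneg : m (-x) x = 1 := by
    have h := hm₁ (-x) x x
    rwa [neg_add_cancel, hm0, hmalt, mul_one, eq_comm] at h
  have hinv : W (-x) (W x ψ) = ψ := by
    have h := congrArg (fun T => T ψ) (hWmul (-x) x)
    simpa [hmneg, hW0] using h
  rw [Submodule.mem_orthogonal] at hψ ⊢
  intro u hu
  rw [← hWunitary (-x), hinv]
  exact hψ _ (hS _ u hu)

/-- A closed invariant subspace containing a set that generates `H` is all of `H`. -/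
theorem eq_top_of_smallestInvariantSubspace_eq_top {G H : Type*} [NormedAddCommGroup H]
    [InnerProductSpace ℂ H] {W : G → H →L[ℂ] H} {K : Set H}
    (hgen : smallestInvariantSubspace W K = ⊤) {S : Submodule ℂ H} (hK : K ⊆ S)
    (hclosed : IsClosed (S : Set H)) (hS : ∀ x : G, ∀ ψ ∈ S, W x ψ ∈ S) : S = ⊤ :=
  top_le_iff.mp (hgen ▸ sInf_le ⟨hK, hclosed, hS⟩)

/-- Standing hypotheses; assume `H^L ≠ {0}`, `H(H^L) = H`, the doubling map
is injective on `G`, and `L = 2L`. Then `W` is irreducible iff the vacuum space `H^L` is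
one-dimensional. -/
theorem stmt_11 {G : Type*} [AddCommGroup G]
    (m : G → G → Circle)
    (hm₁ : ∀ x y z : G, m (x + y) z = m x z * m y z)
    (hm₂ : ∀ x y z : G, m x (y + z) = m x y * m x z)
    (hmalt : ∀ x : G, m x x = 1)
    (L : AddSubgroup G)
    (hL : (L : Set G) = {x : G | ∀ a ∈ L, m x a = 1})
    {H : Type*} [NormedAddCommGroup H] [InnerProductSpace ℂ H] [CompleteSpace H]
    (W : G → H →L[ℂ] H)
    (hW0 : W 0 = 1)
    (hWmul : ∀ x y : G, (W x).comp (W y) = (m x y : ℂ) • W (x + y))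
    (hWunitary : ∀ (x : G) (ψ φ : H), @inner ℂ H _ (W x ψ) (W x φ) = @inner ℂ H _ ψ φ)
    (HL : Submodule ℂ H)
    (hHL : ∀ ψ : H, ψ ∈ HL ↔ ∀ a ∈ L, W a ψ = ψ)
    (hvac : HL ≠ ⊥)
    (hgen : smallestInvariantSubspace W (HL : Set H) = ⊤)
    (hinj : Function.Injective (fun x : G => x + x))
    (h2L : {b : G | ∃ a ∈ L, b = a + a} = (L : Set G)) :
    ((∀ S : Submodule ℂ H, IsClosed (S : Set H) →
        (∀ x : G, ∀ ψ ∈ S, W x ψ ∈ S) → S = ⊥ ∨ S = ⊤) ↔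
      Module.rank ℂ HL = 1) := by
  constructor
  · intro hirr
    obtain ⟨ψ, hψ, hψ0⟩ := (Submodule.ne_bot_iff _).mp hvac
    have horth : ∀ φ ∈ HL, inner ℂ φ ψ = 0 → φ = 0 := by
      intro φ hφ hφψ
      let S : Submodule ℂ H := ⨅ x : G, ((innerSL ℂ φ).comp (W x)).ker
      have hmem : ∀ v, v ∈ S ↔ ∀ x, inner ℂ φ (W x v) = 0 := fun v => by
        simp [S, Submodule.mem_iInf, LinearMap.mem_ker]
      have hclosed : IsClosed (S : Set H) := by
        rw [Submodule.coe_iInf]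
        exact isClosed_iInter fun x => ContinuousLinearMap.isClosed_ker _
      have hinv : ∀ x : G, ∀ v ∈ S, W x v ∈ S := by
        intro x v hv
        rw [hmem] at hv ⊢
        intro y
        have h := congrArg (fun T => T v) (hWmul y x)
        simp only [ContinuousLinearMap.comp_apply, smul_apply] at h
        rw [h, inner_smul_right, hv, mul_zero]
      have hψS : ψ ∈ S := by
        rw [hmem]
        intro x
        by_cases hx : x ∈ L
        · rw [(hHL ψ).mp hψ x hx, hφψ]
        · have hx' : x ∉ {x : G | ∀ a ∈ L, m x a = 1} := hL ▸ hx
          simp only [Set.mem_ofPred_eq, not_forall] at hx'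
          obtain ⟨b, hb, hxb⟩ := hx'
          obtain ⟨a, ha, rfl⟩ : b ∈ {b : G | ∃ a ∈ L, b = a + a} := h2L.symm ▸ hb
          exact inner_vacuum_translate_eq_zero hm₁ hm₂ hmalt hWmul hWunitary hxb
            ((hHL φ).mp hφ a ha) ((hHL ψ).mp hψ a ha)
      have htop : S = ⊤ := (hirr S hclosed hinv).resolve_left
        fun h => hψ0 ((Submodule.mem_bot ℂ).mp (h ▸ hψS))
      have h := (hmem φ).mp (htop ▸ Submodule.mem_top) 0
      rw [hW0] at h
      exact inner_self_eq_zero.mp h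
    rw [rank_submodule_eq_one_iff]
    refine ⟨ψ, hψ, hψ0, fun φ hφ => ?_⟩
    obtain ⟨y, hy, z, hz, rfl⟩ := (ℂ ∙ ψ).exists_add_mem_mem_orthogonal φ
    have hyL : y ∈ HL := (Submodule.span_singleton_le_iff_mem _ _).mpr hψ hy
    have hz0 : z = 0 := horth z ((Submodule.add_mem_iff_right _ hyL).mp hφ)
      (Submodule.mem_orthogonal_singleton_iff_inner_left.mp hz)
    rwa [hz0, add_zero]
  · intro hrank S hclosed hS
    obtain ⟨ψ, hψ, -, hspan⟩ := (rank_submodule_eq_one_iff HL).mp hrank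
    have hSo : ∀ x : G, ∀ v ∈ Sᗮ, W x v ∈ Sᗮ := fun x v hv =>
      map_mem_orthogonal_of_invariant hm₁ hmalt hW0 hWmul hWunitary hS x hv
    have : CompleteSpace S := hclosed.completeSpace_coe
    obtain ⟨p, hp, q, hq, hpq⟩ := S.exists_add_mem_mem_orthogonal ψ
    have hpL : p ∈ HL := by
      rw [hHL]
      intro a ha
      have hsum : W a p - p = q - W a q := by
        have h := (hHL ψ).mp hψ a ha
        rw [hpq, map_add] at h
        rw [sub_eq_sub_iff_add_eq_add, h, add_comm]
      have h0 := Submodule.disjoint_def.mp S.orthogonal_disjoint _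
        (S.sub_mem (hS a p hp) hp) (hsum ▸ Sᗮ.sub_mem hq (hSo a q hq))
      exact sub_eq_zero.mp h0
    obtain ⟨c, rfl⟩ := Submodule.mem_span_singleton.mp (hspan hpL)
    by_cases hc : c = 0
    · left
      have hψS : ψ ∈ Sᗮ := by rw [hpq, hc, zero_smul, zero_add]; exact hq
      have htop := eq_top_of_smallestInvariantSubspace_eq_top hgen
        (hspan.trans ((Submodule.span_singleton_le_iff_mem _ _).mpr hψS))
        S.isClosed_orthogonal hSo
      exact (Submodule.orthogonal_eq_top_iff S).mp htop
    · right
      have hψS : ψ ∈ S := (S.smul_mem_iff hc).mp hp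
      exact eq_top_of_smallestInvariantSubspace_eq_top hgen
        (hspan.trans ((Submodule.span_singleton_le_iff_mem _ _).mpr hψS)) hclosed hS
end

section
/- Standing hypotheses as in the context; assume H^L ≠ {0}, H(H^L) = H, and W irreducible. Then: (a) for all x ∈ (1/2)L, a ∈ L and ψ ∈ H^L, W(x+a)ψ = m(a,x)·W(x)ψ; (b) consequently there exist a map W₀ from the quotient group Q = ((1/2)L)/L to the unitary operators on H^L, a function c : (1/2)L → 𝕋, and a multiplier m₀ on Q such that W(x)ψ = c(x)·W₀(x+L)ψ for all x ∈ (1/2)L and ψ ∈ H^L, W₀(ξ)W₀(η) = m₀(ξ,η)·W₀(ξ+η) for all ξ, η ∈ Q, and m₀(x+L, y+L)/m₀(y+L, x+L) = m(x,y)/m(y,x) for all x, y ∈ (1/2)L. -/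
/-- The subgroup `(1/2)L = {x : 2x ∈ L}`. -/
def halfSub {G : Type*} [AddCommGroup G] (L : AddSubgroup G) : AddSubgroup G :=
  L.comap (doublingHom G)

theorem mem_halfSub {G : Type*} [AddCommGroup G] {L : AddSubgroup G} {x : G} :
    x ∈ halfSub L ↔ x + x ∈ L := Iff.rfl

/-- A surjection admits a section with a prescribed value at one point of its image. -/
theorem Function.Surjective.exists_rightInverse_apply_eq {α β : Type*} {f : α → β}
    (hf : Function.Surjective f) (a : α) :
    ∃ s : β → α, Function.RightInverse s f ∧ s (f a) = a := by
  classical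
  refine ⟨Function.update (Function.surjInv hf) (f a) a, fun b => ?_, by simp⟩
  by_cases h : b = f a
  · simp [h]
  · simp [h, Function.surjInv_eq hf]

theorem alternating_mul_swap {G : Type*} [AddCommGroup G] {m : G → G → Circle}
    (hm₁ : ∀ x y z : G, m (x + y) z = m x z * m y z)
    (hm₂ : ∀ x y z : G, m x (y + z) = m x y * m x z)
    (hmalt : ∀ x : G, m x x = 1) (x y : G) : m x y * m y x = 1 := by
  have h := hmalt (x + y)
  rwa [hm₁, hm₂, hm₂, hmalt, hmalt, one_mul, mul_one] at h

/-- The antisymmetrization of a bihomomorphism that is trivial on `L × L` and alternating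
descends from `(1/2)L` to `(1/2)L / L`. -/
theorem alternating_div_swap_congr {G : Type*} [AddCommGroup G] {m : G → G → Circle}
    (hm₁ : ∀ x y z : G, m (x + y) z = m x z * m y z)
    (hm₂ : ∀ x y z : G, m x (y + z) = m x y * m x z)
    (hmalt : ∀ x : G, m x x = 1) {L : AddSubgroup G}
    (hLL : ∀ x ∈ L, ∀ y ∈ L, m x y = 1) {x y a b : G}
    (hx : x + x ∈ L) (hy : y + y ∈ L) (ha : a ∈ L) (hb : b ∈ L) :
    m (x + a) (y + b) / m (y + b) (x + a) = m x y / m y x := by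
  have hdiv : ∀ u v : G, m u v / m v u = m u v * m u v := fun u v => by
    rw [div_eq_iff_eq_mul, mul_assoc, alternating_mul_swap hm₁ hm₂ hmalt, mul_one]
  have h1 : m a y * m a y = 1 := by rw [← hm₂]; exact hLL _ ha _ hy
  have h2 : m x b * m x b = 1 := by rw [← hm₁]; exact hLL _ hx _ hb
  rw [hdiv, hdiv, hm₁, hm₂, hm₂, hLL a ha b hb, mul_one]
  calc m x y * m x b * m a y * (m x y * m x b * m a y)
      = m x y * m x y * (m x b * m x b) * (m a y * m a y) := by ac_rfl
    _ = m x y * m x y := by rw [h1, h2, mul_one, mul_one]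

/-- A map into the isometries of a nontrivial space that is multiplicative up to the scalars
`m₀` forces the cocycle identity for `m₀`. -/
theorem cocycle_of_projective_isometries {Q E : Type*} [AddCommGroup Q] [NormedAddCommGroup E]
    [InnerProductSpace ℂ E] [Nontrivial E] {V : Q → E →L[ℂ] E} {m₀ : Q → Q → Circle}
    (hV : ∀ ξ ψ φ, inner ℂ (V ξ ψ) (V ξ φ) = inner ℂ ψ φ)
    (hmul : ∀ ξ η, (V ξ).comp (V η) = (m₀ ξ η : ℂ) • V (ξ + η)) (ξ η ζ : Q) :
    m₀ (ξ + η) ζ * m₀ ξ η = m₀ ξ (η + ζ) * m₀ η ζ := by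
  obtain ⟨ψ, hψ⟩ := exists_ne (0 : E)
  have hmul' : ∀ ξ η ψ, V ξ (V η ψ) = (m₀ ξ η : ℂ) • V (ξ + η) ψ :=
    fun ξ η ψ => congrArg (fun T : E →L[ℂ] E => T ψ) (hmul ξ η)
  have hne : V (ξ + η + ζ) ψ ≠ 0 := fun h => hψ <| by
    have := hV (ξ + η + ζ) ψ ψ
    rw [h, inner_zero_left] at this
    exact inner_self_eq_zero.mp this.symm
  have hl : V ξ (V η (V ζ ψ)) = ((m₀ (ξ + η) ζ * m₀ ξ η : Circle) : ℂ) • V (ξ + η + ζ) ψ := by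
    rw [hmul', hmul', smul_smul, Circle.coe_mul, mul_comm]
  have hr : V ξ (V η (V ζ ψ)) = ((m₀ ξ (η + ζ) * m₀ η ζ : Circle) : ℂ) • V (ξ + η + ζ) ψ := by
    rw [hmul' η ζ, map_smul, hmul', smul_smul, Circle.coe_mul, mul_comm, add_assoc]
  exact Circle.coe_injective (smul_left_injective ℂ hne (hl.symm.trans hr))

/-- Standing hypotheses; `H^L ≠ {0}`, `H(H^L) = H`, `W` irreducible. Then
(a) `W(x+a)ψ = m(a,x)·W(x)ψ` for `x ∈ (1/2)L`, `a ∈ L`, `ψ ∈ H^L`; (b) there are a map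
`W₀` from `Q = ((1/2)L)/L` to the unitary operators on `H^L`, a function `c : (1/2)L → 𝕋`
and a multiplier `m₀` on `Q` with `W(x)ψ = c(x)·W₀(x+L)ψ`, `W₀(ξ)W₀(η) = m₀(ξ,η)·W₀(ξ+η)`,
and `m₀∼(x+L, y+L) = m∼(x,y)`. -/
theorem stmt_13 {G : Type*} [AddCommGroup G]
    (m : G → G → Circle)
    (hm₁ : ∀ x y z : G, m (x + y) z = m x z * m y z)
    (hm₂ : ∀ x y z : G, m x (y + z) = m x y * m x z)
    (hmalt : ∀ x : G, m x x = 1)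
    (L : AddSubgroup G)
    (hL : (L : Set G) = {x : G | ∀ a ∈ L, m x a = 1})
    {H : Type*} [NormedAddCommGroup H] [InnerProductSpace ℂ H] [CompleteSpace H]
    (W : G → H →L[ℂ] H)
    (hW0 : W 0 = 1)
    (hWmul : ∀ x y : G, (W x).comp (W y) = (m x y : ℂ) • W (x + y))
    (hWunitary : ∀ (x : G) (ψ φ : H), @inner ℂ H _ (W x ψ) (W x φ) = @inner ℂ H _ ψ φ)
    (HL : Submodule ℂ H)
    (hHL : ∀ ψ : H, ψ ∈ HL ↔ ∀ a ∈ L, W a ψ = ψ)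
    (hvac : HL ≠ ⊥)
    (hgen : smallestInvariantSubspace W (HL : Set H) = ⊤)
    (hirr : ∀ S : Submodule ℂ H, IsClosed (S : Set H) →
      (∀ x : G, ∀ ψ ∈ S, W x ψ ∈ S) → S = ⊥ ∨ S = ⊤) :
    (∀ x a : G, x + x ∈ L → a ∈ L → ∀ ψ : H, (∀ b ∈ L, W b ψ = ψ) →
      W (x + a) ψ = (m a x : ℂ) • W x ψ) ∧
    (∃ (W₀ : (halfSub L ⧸ L.addSubgroupOf (halfSub L)) → (HL →L[ℂ] HL))
       (c : G → Circle)
       (m₀ : (halfSub L ⧸ L.addSubgroupOf (halfSub L)) →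
             (halfSub L ⧸ L.addSubgroupOf (halfSub L)) → Circle),
      (∀ ξ, m₀ ξ 0 = 1 ∧ m₀ 0 ξ = 1) ∧
      (∀ ξ η ζ, m₀ (ξ + η) ζ * m₀ ξ η = m₀ ξ (η + ζ) * m₀ η ζ) ∧
      (∀ ξ (ψ φ : HL), @inner ℂ HL _ (W₀ ξ ψ) (W₀ ξ φ) = @inner ℂ HL _ ψ φ) ∧
      (∀ (x : halfSub L) (ψ : HL),
        W (x : G) (ψ : H) = (c (x : G) : ℂ) • ((W₀ (QuotientAddGroup.mk x) ψ : HL) : H)) ∧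
      (∀ ξ η, (W₀ ξ).comp (W₀ η) = (m₀ ξ η : ℂ) • W₀ (ξ + η)) ∧
      (∀ x y : halfSub L,
        m₀ (QuotientAddGroup.mk x) (QuotientAddGroup.mk y)
            / m₀ (QuotientAddGroup.mk y) (QuotientAddGroup.mk x)
          = m (x : G) (y : G) / m (y : G) (x : G))) := by
  have hLL : ∀ x ∈ L, ∀ y ∈ L, m x y = 1 := fun x hx y hy => by
    have h : x ∈ (L : Set G) := hx
    rw [hL] at h
    exact h y hy
  have hswap := alternating_mul_swap hm₁ hm₂ hmalt
  have hWapp : ∀ x y ψ, W x (W y ψ) = (m x y : ℂ) • W (x + y) ψ :=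
    fun x y ψ => congrArg (fun T : H →L[ℂ] H => T ψ) (hWmul x y)
  have htrans : ∀ x, ∀ a ∈ L, ∀ ψ ∈ HL, W (x + a) ψ = (m a x : ℂ) • W x ψ := by
    intro x a ha ψ hψ
    have h := hWapp x a ψ
    rw [(hHL ψ).mp hψ a ha] at h
    rw [h, smul_smul, ← Circle.coe_mul, hswap, Circle.coe_one, one_smul]
  have hpres : ∀ x ∈ halfSub L, ∀ ψ ∈ HL, W x ψ ∈ HL := by
    refine fun x hx ψ hψ => (hHL _).mpr fun a ha => ?_
    rw [hWapp, add_comm a x, htrans x a ha ψ hψ, smul_smul, ← Circle.coe_mul, ← hm₂,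
      hLL a ha _ (mem_halfSub.mp hx), Circle.coe_one, one_smul]
  refine ⟨fun x a _ ha ψ hψ => htrans x a ha ψ ((hHL ψ).mpr hψ), ?_⟩
  obtain ⟨s, hs, hs0⟩ := (QuotientAddGroup.mk_surjective
    (s := L.addSubgroupOf (halfSub L))).exists_rightInverse_apply_eq 0
  rw [QuotientAddGroup.mk_zero] at hs0
  have hdiff : ∀ x : halfSub L, (x : G) - (s (QuotientAddGroup.mk x) : G) ∈ L := fun x => by
    have h := QuotientAddGroup.eq.mp (hs (QuotientAddGroup.mk x))
    rw [AddSubgroup.mem_addSubgroupOf] at h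
    simpa [sub_eq_neg_add] using h
  let W₀ (ξ : halfSub L ⧸ L.addSubgroupOf (halfSub L)) : HL →L[ℂ] HL :=
    ((W (s ξ)).comp HL.subtypeL).codRestrict HL fun ψ => hpres _ (s ξ).2 ψ ψ.2
  have hc : ∀ (x : halfSub L) (ψ : HL), W (x : G) (ψ : H) =
      (m x (s (QuotientAddGroup.mk x) : G) : ℂ) • ((W₀ (QuotientAddGroup.mk x) ψ : HL) : H) := by
    intro x ψ
    let y : G := s (QuotientAddGroup.mk x)
    have h := htrans y (x - y) (hdiff x) ψ ψ.2
    have h' := hm₁ (x - y) y y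
    rw [sub_add_cancel, hmalt, mul_one] at h'
    rwa [add_sub_cancel, ← h'] at h
  let m₀ (ξ η : halfSub L ⧸ L.addSubgroupOf (halfSub L)) : Circle :=
    m (s ξ) (s η) * m (s ξ + s η) (s (ξ + η))
  have hiso : ∀ ξ (ψ φ : HL), @inner ℂ HL _ (W₀ ξ ψ) (W₀ ξ φ) = @inner ℂ HL _ ψ φ :=
    fun ξ ψ φ => hWunitary (s ξ) ψ φ
  have hmul : ∀ ξ η, (W₀ ξ).comp (W₀ η) = (m₀ ξ η : ℂ) • W₀ (ξ + η) := by
    intro ξ η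
    ext ψ
    have h := hc (s ξ + s η) ψ
    rw [QuotientAddGroup.mk_add, hs, hs, AddSubgroup.coe_add] at h
    change W (s ξ : G) (W (s η : G) ψ) = (m₀ ξ η : ℂ) • ((W₀ (ξ + η) ψ : HL) : H)
    rw [hWapp, h, smul_smul, ← Circle.coe_mul]
  have : Nontrivial HL := Submodule.nontrivial_iff_ne_bot.mpr hvac
  have hzero_right : ∀ x, m x 0 = 1 := fun x => by simpa using hm₂ x 0 0
  have hzero_left : ∀ x, m 0 x = 1 := fun x => by simpa using hm₁ 0 0 x
  classical
  refine ⟨W₀, fun x => if hx : x ∈ halfSub L then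
    m x (s (QuotientAddGroup.mk ⟨x, hx⟩) : G) else 1, m₀, fun ξ => ?_,
    cocycle_of_projective_isometries hiso hmul, hiso, fun x ψ => ?_, hmul, fun x y => ?_⟩
  · simp [m₀, hs0, hzero_left, hzero_right, hmalt]
  · simpa using hc x ψ
  · set ξ : halfSub L ⧸ L.addSubgroupOf (halfSub L) := QuotientAddGroup.mk x with hξ
    set η : halfSub L ⧸ L.addSubgroupOf (halfSub L) := QuotientAddGroup.mk y with hη
    have h := alternating_div_swap_congr hm₁ hm₂ hmalt hLL (mem_halfSub.mp (s ξ).2)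
      (mem_halfSub.mp (s η).2) (hdiff x) (hdiff y)
    rw [← hξ, ← hη, add_sub_cancel, add_sub_cancel] at h
    rw [h]
    simp only [m₀]
    rw [add_comm η ξ, add_comm (s η : G) (s ξ : G), mul_div_mul_right_eq_div]
end

section
/- Let p be a prime, d ≥ 1, and let χ : ℚ_p → 𝕋 be a basic character. Define m on G = ℚ_p^d × ℚ_p^d by m((x₁,x₂),(y₁,y₂)) = χ(x₁·y₂ − x₂·y₁), where x·y = x₁y₁ + … + x_d y_d denotes the standard bilinear form on ℚ_p^d. Then the subgroup L = ℤ_p^d × ℤ_p^d is maximal isotropic for m: m((a₁,a₂),(b₁,b₂)) = 1 for all (a₁,a₂),(b₁,b₂) ∈ L, and conversely any (y₁,y₂) ∈ G satisfying m((a₁,a₂),(y₁,y₂)) = 1 for all (a₁,a₂) ∈ L lies in L. -/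
/-- A map on `ℚ_[p]` that is trivial on the dilate `ℤ_p • y` but not on `p⁻¹ ℤ_p` forces
`y ∈ ℤ_p`. -/
theorem Padic.norm_le_one_of_forall_apply_mul_eq_one {p : ℕ} [Fact p.Prime] {M : Type*} [One M]
    {χ : ℚ_[p] → M} {u y : ℚ_[p]} (hu : ‖(p : ℚ_[p]) * u‖ ≤ 1) (hχu : χ u ≠ 1)
    (hy : ∀ c : ℚ_[p], ‖c‖ ≤ 1 → χ (c * y) = 1) : ‖y‖ ≤ 1 := by
  by_contra! hlt
  have hp : (0 : ℝ) < p := mod_cast (Fact.out : p.Prime).pos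
  have hpy : (p : ℝ) ≤ ‖y‖ := by
    have h := Padic.norm_le_pow_iff_norm_lt_pow_add_one y 0
    simp only [zpow_zero, zero_add, zpow_one] at h
    by_contra! hlt'
    exact absurd (h.2 hlt') hlt.not_ge
  have hup : ‖u‖ ≤ p := by
    rwa [norm_mul, Padic.norm_p, inv_mul_le_iff₀ hp, mul_one] at hu
  have hy0 : y ≠ 0 := norm_pos_iff.1 (one_pos.trans hlt)
  refine hχu ?_
  rw [← div_mul_cancel₀ u hy0]
  refine hy _ ?_
  rw [norm_div]
  exact div_le_one_of_le₀ (hup.trans hpy) (norm_nonneg y)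

theorem Pi.norm_single_apply_le_one {ι E : Type*} [DecidableEq ι] [SeminormedAddCommGroup E]
    {c : E} (hc : ‖c‖ ≤ 1) (i j : ι) : ‖(Pi.single i c : ι → E) j‖ ≤ 1 := by
  rcases eq_or_ne j i with rfl | h
  · simpa using hc
  · simp [h]

theorem Padic.norm_sum_mul_le_one {p : ℕ} [Fact p.Prime] {ι : Type*} [Fintype ι]
    {a b : ι → ℚ_[p]} (ha : ∀ i, ‖a i‖ ≤ 1) (hb : ∀ i, ‖b i‖ ≤ 1) :
    ‖∑ i, a i * b i‖ ≤ 1 := by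
  refine IsUltrametricDist.norm_sum_le_of_forall_le_of_nonneg zero_le_one fun i _ => ?_
  rw [norm_mul]
  exact mul_le_one₀ (ha i) (norm_nonneg _) (hb i)


/-- Let `p` be prime, `d ≥ 1`, `χ : ℚ_p → 𝕋` a basic character, and define
`m((x₁,x₂),(y₁,y₂)) = χ(x₁·y₂ − x₂·y₁)` on `G = ℚ_p^d × ℚ_p^d`. Then `L = ℤ_p^d × ℤ_p^d`
(identified with the pairs with all coordinates of norm `≤ 1`) is maximal isotropic for
`m`. -/
theorem stmt_18 (p : ℕ) [Fact p.Prime] (d : ℕ) (hd : 1 ≤ d)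
    (χ : ℚ_[p] → Circle)
    (hχadd : ∀ x y : ℚ_[p], χ (x + y) = χ x * χ y)
    (hχint : ∀ a : ℚ_[p], ‖a‖ ≤ 1 → χ a = 1)
    (hχbasic : ∃ u : ℚ_[p], ‖(p : ℚ_[p]) * u‖ ≤ 1 ∧ χ u ≠ 1) :
    (∀ a₁ a₂ b₁ b₂ : Fin d → ℚ_[p],
      (∀ i, ‖a₁ i‖ ≤ 1) → (∀ i, ‖a₂ i‖ ≤ 1) → (∀ i, ‖b₁ i‖ ≤ 1) → (∀ i, ‖b₂ i‖ ≤ 1) →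
      χ (∑ i, a₁ i * b₂ i - ∑ i, a₂ i * b₁ i) = 1) ∧
    (∀ y₁ y₂ : Fin d → ℚ_[p],
      (∀ a₁ a₂ : Fin d → ℚ_[p], (∀ i, ‖a₁ i‖ ≤ 1) → (∀ i, ‖a₂ i‖ ≤ 1) →
        χ (∑ i, a₁ i * y₂ i - ∑ i, a₂ i * y₁ i) = 1) →
      (∀ i, ‖y₁ i‖ ≤ 1) ∧ (∀ i, ‖y₂ i‖ ≤ 1)) := by
  obtain ⟨u, hu, hχu⟩ := hχbasic
  refine ⟨fun a₁ a₂ b₁ b₂ ha₁ ha₂ hb₁ hb₂ => hχint _ ?_, fun y₁ y₂ h => ⟨fun i => ?_, fun i => ?_⟩⟩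
  · rw [sub_eq_add_neg]
    refine (IsUltrametricDist.norm_add_le_max _ _).trans ?_
    rw [norm_neg]
    exact max_le (Padic.norm_sum_mul_le_one ha₁ hb₂) (Padic.norm_sum_mul_le_one ha₂ hb₁)
  · refine Padic.norm_le_one_of_forall_apply_mul_eq_one hu hχu fun c hc => ?_
    have hc' : ‖-c‖ ≤ 1 := by rwa [norm_neg]
    simpa [Pi.single_apply] using
      h 0 (Pi.single i (-c)) (by simp) (Pi.norm_single_apply_le_one hc' i)
  · refine Padic.norm_le_one_of_forall_apply_mul_eq_one hu hχu fun c hc => ?_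
    simpa [Pi.single_apply] using
      h (Pi.single i c) 0 (Pi.norm_single_apply_le_one hc i) (by simp)
end

section
/- Let p be an odd prime, d ≥ 1, and let χ : ℚ_p → 𝕋 be a basic character. Suppose f : ℚ_p^d → ℂ satisfies f(s + a₁) = χ(2 s·a₂)⁻¹ · f(s) for all s ∈ ℚ_p^d and all a₁, a₂ ∈ ℤ_p^d, where s·a = s₁a₁ + … + s_d a_d. Then f(s) = f(0) for every s ∈ ℤ_p^d and f(s) = 0 for every s ∉ ℤ_p^d; in particular, the space of such functions is at most one-dimensional, spanned by the indicator function of ℤ_p^d. -/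
/-- For odd `p`, if `u` lies in `p⁻¹ ℤ_p` and `x` is not a `p`-adic integer, then `u / (2 * x)` is
a `p`-adic integer. -/
theorem Padic.norm_div_two_mul_le_one {p : ℕ} [Fact p.Prime] (hodd : p ≠ 2) {u x : ℚ_[p]}
    (hu : ‖(p : ℚ_[p]) * u‖ ≤ 1) (hx : 1 < ‖x‖) : ‖u / (2 * x)‖ ≤ 1 := by
  have hp : (0 : ℝ) < p := mod_cast (Fact.out : p.Prime).pos
  have h2 : ‖(2 : ℚ_[p])‖ = 1 := mod_cast Padic.norm_natCast_eq_one_iff.mpr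
    ((Nat.coprime_primes Fact.out Nat.prime_two).mpr hodd)
  have hxp : (p : ℝ) ≤ ‖x‖ := by
    by_contra! h
    have := (Padic.norm_le_pow_iff_norm_lt_pow_add_one x 0).mpr (by simpa using h)
    rw [zpow_zero] at this
    exact this.not_gt hx
  have hup : ‖u‖ ≤ p := by
    rwa [norm_mul, Padic.norm_p, inv_mul_le_iff₀ hp, mul_one] at hu
  rw [norm_div, norm_mul, h2, one_mul]
  exact div_le_one_of_le₀ (hup.trans hxp) (norm_nonneg x)


/-- Let `p` be an odd prime, `d ≥ 1`, `χ : ℚ_p → 𝕋` a basic character, and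
suppose `f : ℚ_p^d → ℂ` satisfies `f(s + a₁) = χ(2 s·a₂)⁻¹ · f(s)` for all `s` and all
`a₁, a₂ ∈ ℤ_p^d`. Then `f` is constant equal to `f(0)` on `ℤ_p^d` and vanishes off
`ℤ_p^d`; in particular the space of such `f` is spanned by the indicator of `ℤ_p^d`. -/
theorem stmt_19 (p : ℕ) [Fact p.Prime] (hodd : p ≠ 2) (d : ℕ) (hd : 1 ≤ d)
    (χ : ℚ_[p] → Circle)
    (hχadd : ∀ x y : ℚ_[p], χ (x + y) = χ x * χ y)
    (hχint : ∀ a : ℚ_[p], ‖a‖ ≤ 1 → χ a = 1)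
    (hχbasic : ∃ u : ℚ_[p], ‖(p : ℚ_[p]) * u‖ ≤ 1 ∧ χ u ≠ 1)
    (f : (Fin d → ℚ_[p]) → ℂ)
    (hf : ∀ (s a₁ a₂ : Fin d → ℚ_[p]), (∀ i, ‖a₁ i‖ ≤ 1) → (∀ i, ‖a₂ i‖ ≤ 1) →
      f (s + a₁) = ((χ (2 * ∑ i, s i * a₂ i) : ℂ))⁻¹ * f s) :
    (∀ s : Fin d → ℚ_[p], (∀ i, ‖s i‖ ≤ 1) → f s = f 0) ∧
    (∀ s : Fin d → ℚ_[p], ¬ (∀ i, ‖s i‖ ≤ 1) → f s = 0) := by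
  have hχ0 : χ 0 = 1 := hχint 0 (by simp)
  refine ⟨fun s hs ↦ ?_, fun s hs ↦ ?_⟩
  · simpa [hχ0] using hf 0 s 0 hs (by simp)
  · push Not at hs
    obtain ⟨i, hi⟩ := hs
    obtain ⟨u, hu, hχu⟩ := hχbasic
    have hsi : s i ≠ 0 := norm_pos_iff.mp (one_pos.trans hi)
    set t := u / (2 * s i) with ht
    have htn : ‖t‖ ≤ 1 := Padic.norm_div_two_mul_le_one hodd hu hi
    have h2t : 2 * (s i * t) = u := by rw [ht]; field_simp
    have key := hf s 0 (Pi.single i t) (by simp) fun j ↦ by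
      rcases eq_or_ne j i with rfl | hj
      · simpa using htn
      · simp [hj]
    have hsum : ∑ j, s j * (Pi.single i t : Fin d → ℚ_[p]) j = s i * t := by
      simp [Pi.single_apply]
    rw [hsum, h2t, add_zero] at key
    by_contra hfs
    have hinv : ((χ u : ℂ))⁻¹ = 1 := mul_right_cancel₀ hfs (by rw [← key, one_mul])
    exact hχu (Circle.ext (by simpa using hinv))
end
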